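/- arXiv:2510.05241 — 2 statements merged into one kernel-verified Lean document; each statement's English description precedes it below -/
import Mathlib

section
/- Suppose Assumption A holds, θ* ∈ Θ, and {(x_k, y_k)} are the Naive accelerated primal-dual iterates with constant step-sizes τ, σ > 0, momentum η = 1, weights t_k = 1 (so T_K = K), and α, β > 0 with 1/τ ≥ (L_yx)²/α + L_xx and 1/σ ≥ (α + β) + 2(L_yy)²/β. Suppose additionally that R_x = sup_{x, x̄ ∈ dom f} D_X(x, x̄) < ∞ and R_y = sup_{y, ȳ ∈ dom h} D_Y(y, ȳ) < ∞, and that there exists C_θ > 0 with ‖θ_k − θ*‖ ≤ √C_θ/(k+1) for all k ≥ 0. Then for every x ∈ dom f, y ∈ dom h, and K ≥ 1: L(x̄_K, y; θ*) − L(x, ȳ_K; θ*) ≤ (1/K)[(1/τ)R_x + (1/σ)R_y] + ((1 + log K)/K)·√(2 C_θ)·(L_xθ √R_x + 3 L_yθ √R_y), where x̄_K = (1/K)Σ_{k=0}^{K−1} x_{k+1} and ȳ_K = (1/K)Σ_{k=0}^{K−1} y_{k+1}. -/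
open RealInnerProductSpace

/-- A function that is bounded below by `-t * c` along `(0, 1]` has right slope at least `-c`. -/
theorem nonneg_add_deriv_of_forall_nonneg {F : ℝ → ℝ} {m c : ℝ} (hF : HasDerivAt F m 0)
    (hc : ∀ t : ℝ, 0 < t → t ≤ 1 → 0 ≤ t * c + (F t - F 0)) : 0 ≤ c + m := by
  have hlim := ((hasDerivAt_iff_tendsto_slope_zero.1 hF).mono_left
    (nhdsWithin_mono 0 fun t (ht : t ∈ Set.Ioi 0) => ne_of_gt ht)).const_add c
  refine ge_of_tendsto hlim ?_
  filter_upwards [Ioc_mem_nhdsGT (zero_lt_one (α := ℝ))] with t ht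
  have h1 := mul_nonneg (inv_nonneg.2 ht.1.le) (hc t ht.1 ht.2)
  rw [mul_add, inv_mul_cancel_left₀ ht.1.ne'] at h1
  simpa using h1

section Gradient

variable {E : Type*} [NormedAddCommGroup E] [InnerProductSpace ℝ E] [CompleteSpace E]

theorem HasGradientAt.hasDerivAt_line {g : E → ℝ} {g' p d : E} {t : ℝ}
    (hg : HasGradientAt g g' (p + t • d)) :
    HasDerivAt (fun s : ℝ => g (p + s • d)) ⟪g', d⟫ t := by
  have hline : HasDerivAt (fun s : ℝ => p + s • d) d t := by
    simpa using ((hasDerivAt_id t).smul_const d).const_add p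
  exact (hg.hasFDerivAt.comp_hasDerivAt t hline).congr_deriv
    (InnerProductSpace.toDual_apply_apply ..)

theorem ConvexOn.add_inner_gradient_le {s : Set E} {g : E → ℝ} {g' p u : E}
    (hconv : ConvexOn ℝ s g) (hp : p ∈ s) (hu : u ∈ s) (hg : HasGradientAt g g' p) :
    g p + ⟪g', u - p⟫ ≤ g u := by
  have hd : HasDerivAt (fun t : ℝ => g (p + t • (u - p))) ⟪g', u - p⟫ 0 :=
    HasGradientAt.hasDerivAt_line (by simpa using hg)
  have := nonneg_add_deriv_of_forall_nonneg (c := g u - g p) hd.fun_neg fun t h0 h1 => by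
    have h2 := hconv.2 hp hu (sub_nonneg.2 h1) h0.le (by ring)
    have h3 : (1 - t) • p + t • u = p + t • (u - p) := by module
    rw [h3] at h2
    simp only [smul_eq_mul, zero_smul, add_zero] at h2 ⊢
    linarith
  linarith

theorem ConcaveOn.le_add_inner_gradient {s : Set E} {g : E → ℝ} {g' p u : E}
    (hconc : ConcaveOn ℝ s g) (hp : p ∈ s) (hu : u ∈ s) (hg : HasGradientAt g g' p) :
    g u ≤ g p + ⟪g', u - p⟫ := by
  have hd : HasDerivAt (fun t : ℝ => g (p + t • (u - p))) ⟪g', u - p⟫ 0 :=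
    HasGradientAt.hasDerivAt_line (by simpa using hg)
  have := nonneg_add_deriv_of_forall_nonneg (c := g p - g u) hd fun t h0 h1 => by
    have h2 := hconc.2 hp hu (sub_nonneg.2 h1) h0.le (by ring)
    have h3 : (1 - t) • p + t • u = p + t • (u - p) := by module
    rw [h3] at h2
    simp only [smul_eq_mul, zero_smul, add_zero] at h2 ⊢
    linarith
  linarith

/-- The descent lemma on a convex set. -/
theorem Convex.le_add_inner_gradient_add_sq {s : Set E} (hs : Convex ℝ s) {g : E → ℝ}
    {g' : E → E} {L : ℝ} (hg : ∀ x ∈ s, HasGradientAt g (g' x) x)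
    (hL : ∀ x ∈ s, ∀ y ∈ s, ‖g' x - g' y‖ ≤ L * ‖x - y‖) {p u : E} (hp : p ∈ s) (hu : u ∈ s) :
    g u ≤ g p + ⟪g' p, u - p⟫ + L / 2 * ‖u - p‖ ^ 2 := by
  have hmem : ∀ t ∈ Set.Icc (0 : ℝ) 1, p + t • (u - p) ∈ s := fun t ht =>
    hs.add_smul_sub_mem hp hu ht
  have hd : ∀ t ∈ Set.Icc (0 : ℝ) 1,
      HasDerivAt (fun t : ℝ => g (p + t • (u - p)) -
        (t * ⟪g' p, u - p⟫ + t ^ 2 * (L / 2 * ‖u - p‖ ^ 2)))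
        (⟪g' (p + t • (u - p)), u - p⟫ -
          (1 * ⟪g' p, u - p⟫ + (2 : ℕ) * t ^ (2 - 1) * (L / 2 * ‖u - p‖ ^ 2))) t := fun t ht =>
    (hg _ (hmem t ht)).hasDerivAt_line.sub
      (((hasDerivAt_id t).mul_const _).add ((hasDerivAt_pow 2 t).mul_const _))
  have hanti := antitoneOn_of_deriv_nonpos (convex_Icc (0 : ℝ) 1)
    (fun t ht => (hd t ht).continuousAt.continuousWithinAt)
    (fun t ht => (hd t (interior_subset ht)).differentiableAt.differentiableWithinAt)
    (fun t ht => by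
      have ht' := interior_subset ht
      rw [(hd t ht').deriv]
      have h1 := hL _ (hmem t ht') p hp
      rw [add_sub_cancel_left, norm_smul, Real.norm_of_nonneg ht'.1] at h1
      have h2 := real_inner_le_norm (g' (p + t • (u - p)) - g' p) (u - p)
      rw [inner_sub_left] at h2
      have h3 := mul_le_mul_of_nonneg_right h1 (norm_nonneg (u - p))
      push_cast
      norm_num
      nlinarith)
  have h := hanti (Set.left_mem_Icc.2 zero_le_one) (Set.right_mem_Icc.2 zero_le_one) zero_le_one
  simp only [one_smul, zero_smul, add_zero, add_sub_cancel] at h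
  linarith

/-- The three-point inequality for a Bregman proximal step. -/
theorem ConvexOn.bregman_prox_three_point {s : Set E} {f φ : E → ℝ} {gφ : E → E} {D : E → E → ℝ}
    {v p q u : E} {c : ℝ} (hf : ConvexOn ℝ s f)
    (hD : ∀ x x', D x x' = φ x - φ x' - ⟪gφ x', x - x'⟫)
    (hφ : HasGradientAt φ (gφ p) p) (hp : p ∈ s) (hu : u ∈ s)
    (hmin : ∀ z ∈ s, f p + ⟪v, p⟫ + c * D p q ≤ f z + ⟪v, z⟫ + c * D z q) :
    f p - f u ≤ ⟪v, u - p⟫ + c * (D u q - D u p - D p q) := by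
  have hd : HasDerivAt (fun t : ℝ => c * φ (p + t • (u - p))) (c * ⟪gφ p, u - p⟫) 0 :=
    (HasGradientAt.hasDerivAt_line (by simpa using hφ)).const_mul c
  have h := nonneg_add_deriv_of_forall_nonneg
      (c := f u - f p + ⟪v, u - p⟫ - c * ⟪gφ q, u - p⟫) hd fun t h0 h1 => by
    have h2 := hf.2 hp hu (sub_nonneg.2 h1) h0.le (by ring)
    have h3 : (1 - t) • p + t • u = p + t • (u - p) := by module
    rw [h3] at h2
    have h4 := hmin _ (hf.1.add_smul_sub_mem hp hu ⟨h0.le, h1⟩)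
    rw [hD, hD, inner_add_right, real_inner_smul_right, add_sub_right_comm, inner_add_right,
      real_inner_smul_right] at h4
    simp only [smul_eq_mul, zero_smul, add_zero] at h2 ⊢
    linarith
  have h5 : ⟪gφ q, u - q⟫ = ⟪gφ q, u - p⟫ + ⟪gφ q, p - q⟫ := by
    rw [← inner_add_right, sub_add_sub_cancel]
  rw [hD, hD, hD, h5]
  linarith

end Gradient

theorem mul_le_weighted_sq_add_sq {L a b γ : ℝ} (hγ : 0 < γ) :
    L * a * b ≤ L ^ 2 / (2 * γ) * a ^ 2 + γ / 2 * b ^ 2 := by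
  have h : L ^ 2 / (2 * γ) * a ^ 2 + γ / 2 * b ^ 2 - L * a * b =
      (L * a - γ * b) ^ 2 / (2 * γ) := by
    field_simp
    ring
  have := div_nonneg (sq_nonneg (L * a - γ * b)) (by positivity : 0 ≤ 2 * γ)
  linarith

theorem sum_range_inv_succ_le_one_add_log (n : ℕ) :
    ∑ k ∈ Finset.range n, ((k : ℝ) + 1)⁻¹ ≤ 1 + Real.log n := by
  simpa [harmonic] using harmonic_le_one_add_log n

theorem le_sqrt_two_mul_of_half_sq_le {a R : ℝ} (h : 1 / 2 * a ^ 2 ≤ R) :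
    a ≤ Real.sqrt (2 * R) :=
  Real.le_sqrt_of_sq_le (by linarith)

theorem ConvexOn.map_range_average_le {E : Type*} [AddCommGroup E] [Module ℝ E] {s : Set E} {g : E → ℝ}
    (hg : ConvexOn ℝ s g) {n : ℕ} (hn : 1 ≤ n) {z : ℕ → E} (hz : ∀ k, z k ∈ s) :
    g ((n : ℝ)⁻¹ • ∑ k ∈ Finset.range n, z k) ≤ (n : ℝ)⁻¹ * ∑ k ∈ Finset.range n, g (z k) := by
  have hn' : (n : ℝ) ≠ 0 := by positivity
  rw [Finset.smul_sum, Finset.mul_sum]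
  refine hg.map_sum_le (fun _ _ => by positivity) ?_ (fun k _ => hz k)
  simp [hn']

theorem stmt_5
    {X : Type*} [NormedAddCommGroup X] [InnerProductSpace ℝ X] [FiniteDimensional ℝ X]
    {Y : Type*} [NormedAddCommGroup Y] [InnerProductSpace ℝ Y] [FiniteDimensional ℝ Y]
    {T : Type*} [NormedAddCommGroup T] [InnerProductSpace ℝ T] [FiniteDimensional ℝ T]
    (domf : Set X) (domh : Set Y) (Θset : Set T)
    (hdomf_ne : domf.Nonempty) (hdomh_ne : domh.Nonempty)
    (hdomf_conv : Convex ℝ domf) (hdomh_conv : Convex ℝ domh)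
    (f : X → ℝ) (h : Y → ℝ)
    (hfconv : ConvexOn ℝ domf f) (hhconv : ConvexOn ℝ domh h)
    (hflsc : LowerSemicontinuousOn f domf) (hhlsc : LowerSemicontinuousOn h domh)
    (Φ : X → Y → T → ℝ) (gradxΦ : X → Y → T → X) (gradyΦ : X → Y → T → Y)
    (Lxx Lxθ Lyx Lyy Lyθ : ℝ)
    (hLxx : 0 ≤ Lxx) (hLxθ : 0 ≤ Lxθ) (hLyx : 0 ≤ Lyx) (hLyy : 0 ≤ Lyy) (hLyθ : 0 ≤ Lyθ)
    (hΦconvx : ∀ y ∈ domh, ∀ θ ∈ Θset, ConvexOn ℝ domf (fun x => Φ x y θ))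
    (hΦconcy : ∀ x ∈ domf, ∀ θ ∈ Θset, ConcaveOn ℝ domh (fun y => Φ x y θ))
    (hgradx : ∀ x ∈ domf, ∀ y ∈ domh, ∀ θ ∈ Θset,
      HasGradientAt (fun x' => Φ x' y θ) (gradxΦ x y θ) x)
    (hgrady : ∀ x ∈ domf, ∀ y ∈ domh, ∀ θ ∈ Θset,
      HasGradientAt (fun y' => Φ x y' θ) (gradyΦ x y θ) y)
    (hLipx : ∀ x ∈ domf, ∀ x' ∈ domf, ∀ y ∈ domh, ∀ θ ∈ Θset, ∀ θ' ∈ Θset,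
      ‖gradxΦ x y θ - gradxΦ x' y θ'‖ ≤ Lxx * ‖x - x'‖ + Lxθ * ‖θ - θ'‖)
    (hLipy : ∀ x ∈ domf, ∀ x' ∈ domf, ∀ y ∈ domh, ∀ y' ∈ domh, ∀ θ ∈ Θset, ∀ θ' ∈ Θset,
      ‖gradyΦ x y θ - gradyΦ x' y' θ'‖ ≤ Lyx * ‖x - x'‖ + Lyy * ‖y - y'‖ + Lyθ * ‖θ - θ'‖)
    (φX : X → ℝ) (gφX : X → X) (UX : Set X) (hUXopen : IsOpen UX) (hUXf : domf ⊆ UX)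
    (hφX : ∀ x ∈ UX, HasGradientAt φX (gφX x) x)
    (DX : X → X → ℝ)
    (hDXdef : ∀ x x', DX x x' = φX x - φX x' - ⟪gφX x', x - x'⟫)
    (hDXlb : ∀ x, ∀ x' ∈ domf, 1 / 2 * ‖x - x'‖ ^ 2 ≤ DX x x')
    (φY : Y → ℝ) (gφY : Y → Y) (UY : Set Y) (hUYopen : IsOpen UY) (hUYh : domh ⊆ UY)
    (hφY : ∀ y ∈ UY, HasGradientAt φY (gφY y) y)
    (DY : Y → Y → ℝ)
    (hDYdef : ∀ y y', DY y y' = φY y - φY y' - ⟪gφY y', y - y'⟫)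
    (hDYlb : ∀ y, ∀ y' ∈ domh, 1 / 2 * ‖y - y'‖ ^ 2 ≤ DY y y')
    (θstar : T) (hθstar : θstar ∈ Θset)
    (τ σ η : ℝ) (hτ : 0 < τ) (hσ : 0 < σ) (hη : 0 ≤ η)
    (xx : ℕ → X) (yy : ℕ → Y) (θθ : ℕ → T)
    (hxx : ∀ k, xx k ∈ domf) (hyy : ∀ k, yy k ∈ domh) (hθθ : ∀ k, θθ k ∈ Θset)
    (hyupd : ∀ k : ℕ, ∀ y' ∈ domh,
      h (yy (k + 1))
        - ⟪(1 + η) • gradyΦ (xx k) (yy k) (θθ k)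
            - η • gradyΦ (xx (k - 1)) (yy (k - 1)) (θθ k), yy (k + 1)⟫
        + 1 / σ * DY (yy (k + 1)) (yy k)
      ≤ h y'
        - ⟪(1 + η) • gradyΦ (xx k) (yy k) (θθ k)
            - η • gradyΦ (xx (k - 1)) (yy (k - 1)) (θθ k), y'⟫
        + 1 / σ * DY y' (yy k))
    (hxupd : ∀ k : ℕ, ∀ x' ∈ domf,
      f (xx (k + 1)) + ⟪gradxΦ (xx k) (yy (k + 1)) (θθ k), xx (k + 1)⟫
        + 1 / τ * DX (xx (k + 1)) (xx k)
      ≤ f x' + ⟪gradxΦ (xx k) (yy (k + 1)) (θθ k), x'⟫ + 1 / τ * DX x' (xx k))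
    (hη1 : η = 1)
    (α β : ℝ) (hα : 0 < α) (hβ : 0 < β)
    (hstep1 : 1 / τ ≥ Lyx ^ 2 / α + Lxx)
    (hstep2 : 1 / σ ≥ (α + β) + 2 * Lyy ^ 2 / β)
    (Rx Ry : ℝ)
    (hRx : ∀ x ∈ domf, ∀ x' ∈ domf, DX x x' ≤ Rx)
    (hRy : ∀ y ∈ domh, ∀ y' ∈ domh, DY y y' ≤ Ry)
    (Cθ : ℝ) (hCθ : 0 < Cθ)
    (hθrate : ∀ k : ℕ, ‖θθ k - θstar‖ ≤ Real.sqrt Cθ / ((k : ℝ) + 1)) :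
    ∀ K : ℕ, 1 ≤ K →
    ∀ xb : X, xb = ((K : ℝ))⁻¹ • ∑ k ∈ Finset.range K, xx (k + 1) →
    ∀ yb : Y, yb = ((K : ℝ))⁻¹ • ∑ k ∈ Finset.range K, yy (k + 1) →
    ∀ x ∈ domf, ∀ y ∈ domh,
      (f xb + Φ xb y θstar - h y) - (f x + Φ x yb θstar - h yb)
      ≤ 1 / (K : ℝ) * (1 / τ * Rx + 1 / σ * Ry)
        + (1 + Real.log (K : ℝ)) / (K : ℝ) * Real.sqrt (2 * Cθ)
          * (Lxθ * Real.sqrt Rx + 3 * Lyθ * Real.sqrt Ry) := by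
  subst hη1
  intro K hK xb hxb yb hyb x hx y hy
  set G : ℕ → Y := fun k => gradyΦ (xx k) (yy k) θstar with hG
  set q : ℕ → Y := fun k => G k - G (k - 1) with hq
  set E : ℕ → ℝ := fun k => 1 / τ * DX x (xx k) + 1 / σ * DY y (yy k) - ⟪q k, y - yy k⟫
    + Lyx ^ 2 / (2 * α) * ‖xx k - xx (k - 1)‖ ^ 2
    + Lyy ^ 2 / (2 * β) * ‖yy k - yy (k - 1)‖ ^ 2 with hE
  set C : ℝ := Real.sqrt (2 * Cθ) * (Lxθ * Real.sqrt Rx + 3 * Lyθ * Real.sqrt Ry) with hC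
  have hqle : ∀ k (v : Y), ⟪q k, v⟫ ≤ Lyx ^ 2 / (2 * α) * ‖xx k - xx (k - 1)‖ ^ 2
      + Lyy ^ 2 / (2 * β) * ‖yy k - yy (k - 1)‖ ^ 2 + (α + β) / 2 * ‖v‖ ^ 2 := by
    intro k v
    have h1 := hLipy _ (hxx k) _ (hxx (k - 1)) _ (hyy k) _ (hyy (k - 1)) _ hθstar _ hθstar
    rw [sub_self, norm_zero, mul_zero, add_zero] at h1
    have h2 := mul_le_mul_of_nonneg_right h1 (norm_nonneg v)
    have h3 := real_inner_le_norm (q k) v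
    have h4 := mul_le_weighted_sq_add_sq (L := Lyx) (a := ‖xx k - xx (k - 1)‖) (b := ‖v‖) hα
    have h5 := mul_le_weighted_sq_add_sq (L := Lyy) (a := ‖yy k - yy (k - 1)‖) (b := ‖v‖) hβ
    simp only [hq, hG] at h3 ⊢
    linarith
  have hstep1' : Lyx ^ 2 / (2 * α) = Lyx ^ 2 / α / 2 := by rw [div_div, mul_comm]
  have hstep2' : Lyy ^ 2 / (2 * β) = Lyy ^ 2 / β / 2 := by rw [div_div, mul_comm]
  have hLyyβ : 0 ≤ Lyy ^ 2 / β := by positivity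
  have hστ : 0 < 1 / σ ∧ 0 < 1 / τ := ⟨by positivity, by positivity⟩
  have hstepσ : (α + β) + 2 * (Lyy ^ 2 / β) ≤ 1 / σ := by
    rw [← mul_div_assoc]
    exact hstep2
  have hgap : ∀ k, (f (xx (k + 1)) + Φ (xx (k + 1)) y θstar - h y)
      - (f x + Φ x (yy (k + 1)) θstar - h (yy (k + 1)))
      ≤ E k - E (k + 1) + C * ((k : ℝ) + 1)⁻¹ := by
    intro k
    have hconc := (hΦconcy _ (hxx (k + 1)) _ hθstar).le_add_inner_gradient (hyy (k + 1)) hy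
      (hgrady _ (hxx (k + 1)) _ (hyy (k + 1)) _ hθstar)
    have hconv := (hΦconvx _ (hyy (k + 1)) _ hθstar).add_inner_gradient_le (hxx k) hx
      (hgradx _ (hxx k) _ (hyy (k + 1)) _ hθstar)
    have hdesc := hdomf_conv.le_add_inner_gradient_add_sq
      (fun z hz => hgradx z hz _ (hyy (k + 1)) _ hθstar)
      (fun z hz w hw => by
        simpa using hLipx z hz w hw _ (hyy (k + 1)) _ hθstar _ hθstar) (hxx k) (hxx (k + 1))
    have hproxx := hfconv.bregman_prox_three_point hDXdef (hφX _ (hUXf (hxx (k + 1))))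
      (hxx (k + 1)) hx (hxupd k)
    have hproxy := hhconv.bregman_prox_three_point hDYdef (hφY _ (hUYh (hyy (k + 1))))
      (hyy (k + 1)) hy
      (v := -((1 + (1 : ℝ)) • gradyΦ (xx k) (yy k) (θθ k)
        - (1 : ℝ) • gradyΦ (xx (k - 1)) (yy (k - 1)) (θθ k)))
      (fun z hz => by
        rw [inner_neg_left, inner_neg_left, ← sub_eq_add_neg, ← sub_eq_add_neg]
        exact hyupd k z hz)
    have hDxk := mul_le_mul_of_nonneg_left (hDXlb (xx (k + 1)) _ (hxx k)) hστ.2.le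
    have hDyk := mul_le_mul_of_nonneg_left (hDYlb (yy (k + 1)) _ (hyy k)) hστ.1.le
    have hxk := mul_le_mul_of_nonneg_right hstep1 (sq_nonneg ‖xx (k + 1) - xx k‖)
    have hyk := mul_le_mul_of_nonneg_right hstepσ (sq_nonneg ‖yy (k + 1) - yy k‖)
    have hyk' := mul_nonneg hLyyβ (sq_nonneg ‖yy (k + 1) - yy k‖)
    have hqk := hqle k (yy (k + 1) - yy k)
    have hθk := hθrate k
    have hxerr : ⟪gradxΦ (xx k) (yy (k + 1)) θstar - gradxΦ (xx k) (yy (k + 1)) (θθ k),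
        xx (k + 1) - x⟫ ≤ Lxθ * (Real.sqrt Cθ / ((k : ℝ) + 1)) * Real.sqrt (2 * Rx) := by
      refine (real_inner_le_norm _ _).trans (mul_le_mul ?_ ?_ (norm_nonneg _) (by positivity))
      · have := hLipx _ (hxx k) _ (hxx k) _ (hyy (k + 1)) _ hθstar _ (hθθ k)
        rw [sub_self, norm_zero, mul_zero, zero_add, norm_sub_rev θstar] at this
        exact this.trans (mul_le_mul_of_nonneg_left hθk hLxθ)
      · exact le_sqrt_two_mul_of_half_sq_le
          ((hDXlb _ _ hx).trans (hRx _ (hxx (k + 1)) _ hx))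
    have hyθ : ∀ j, ‖gradyΦ (xx j) (yy j) (θθ k) - G j‖
        ≤ Lyθ * (Real.sqrt Cθ / ((k : ℝ) + 1)) := by
      intro j
      have := hLipy _ (hxx j) _ (hxx j) _ (hyy j) _ (hyy j) _ (hθθ k) _ hθstar
      rw [sub_self, norm_zero, sub_self, norm_zero, mul_zero, mul_zero, zero_add, zero_add] at this
      exact this.trans (mul_le_mul_of_nonneg_left hθk hLyθ)
    have hyerr : ⟪(2 : ℝ) • (gradyΦ (xx k) (yy k) (θθ k) - G k)
          - (gradyΦ (xx (k - 1)) (yy (k - 1)) (θθ k) - G (k - 1)), yy (k + 1) - y⟫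
        ≤ 3 * (Lyθ * (Real.sqrt Cθ / ((k : ℝ) + 1))) * Real.sqrt (2 * Ry) := by
      refine (real_inner_le_norm _ _).trans (mul_le_mul ?_ ?_ (norm_nonneg _) (by positivity))
      · refine (norm_sub_le _ _).trans ?_
        rw [norm_smul, Real.norm_of_nonneg (by norm_num)]
        have h1 := hyθ k
        have h2 := hyθ (k - 1)
        linarith
      · exact le_sqrt_two_mul_of_half_sq_le
          ((hDYlb _ _ hy).trans (hRy _ (hyy (k + 1)) _ hy))
    have hCk : Lxθ * (Real.sqrt Cθ / ((k : ℝ) + 1)) * Real.sqrt (2 * Rx)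
        + 3 * (Lyθ * (Real.sqrt Cθ / ((k : ℝ) + 1))) * Real.sqrt (2 * Ry)
        = C * ((k : ℝ) + 1)⁻¹ := by
      rw [hC, Real.sqrt_mul (by norm_num), Real.sqrt_mul (by norm_num),
        Real.sqrt_mul (by norm_num)]
      ring
    simp only [hE, hq, hG, add_tsub_cancel_right, one_smul, hstep1', hstep2', one_add_one_eq_two,
      inner_sub_left, inner_sub_right, inner_neg_left, real_inner_smul_left] at *
    linarith
  have hE0 : E 0 ≤ 1 / τ * Rx + 1 / σ * Ry := by
    have h1 := mul_le_mul_of_nonneg_left (hRx _ hx _ (hxx 0)) hστ.2.le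
    have h2 := mul_le_mul_of_nonneg_left (hRy _ hy _ (hyy 0)) hστ.1.le
    simp only [hE, hq, zero_tsub, sub_self, inner_zero_left, norm_zero]
    linarith
  have hEK : 0 ≤ E K := by
    have h1 := hqle K (y - yy K)
    have h2 := mul_le_mul_of_nonneg_left (hDYlb y _ (hyy K)) hστ.1.le
    have h3 := mul_le_mul_of_nonneg_left
      ((by positivity : 0 ≤ 1 / 2 * ‖x - xx K‖ ^ 2).trans (hDXlb x _ (hxx K))) hστ.2.le
    have h4 := mul_le_mul_of_nonneg_right (show α + β ≤ 1 / σ by linarith)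
      (sq_nonneg ‖y - yy K‖)
    simp only [hE]
    linarith
  have hC0 : 0 ≤ C := by positivity
  have hsum := Finset.sum_le_sum fun k (_ : k ∈ Finset.range K) => hgap k
  rw [Finset.sum_add_distrib, Finset.sum_range_sub', ← Finset.mul_sum] at hsum
  have hlog := mul_le_mul_of_nonneg_left (sum_range_inv_succ_le_one_add_log K) hC0
  have hJx := (hfconv.add (hΦconvx y hy _ hθstar)).map_range_average_le hK fun k => hxx (k + 1)
  have hJy := (hhconv.sub (hΦconcy x hx _ hθstar)).map_range_average_le hK fun k => hyy (k + 1)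
  rw [← hxb] at hJx
  rw [← hyb] at hJy
  have hK0 : (0 : ℝ) < K := by exact_mod_cast hK
  have hbound := mul_le_mul_of_nonneg_left (hsum.trans (by linarith :
    _ ≤ 1 / τ * Rx + 1 / σ * Ry + C * (1 + Real.log K))) (inv_nonneg.2 hK0.le)
  simp only [Pi.add_apply, Pi.sub_apply] at hJx hJy
  have hsplit : (K : ℝ)⁻¹ * ∑ k ∈ Finset.range K,
      ((f (xx (k + 1)) + Φ (xx (k + 1)) y θstar - h y)
        - (f x + Φ x (yy (k + 1)) θstar - h (yy (k + 1))))
      = (K : ℝ)⁻¹ * ∑ k ∈ Finset.range K, (f (xx (k + 1)) + Φ (xx (k + 1)) y θstar)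
        + (K : ℝ)⁻¹ * ∑ k ∈ Finset.range K, (h (yy (k + 1)) - Φ x (yy (k + 1)) θstar)
        - h y - f x := by
    simp only [Finset.sum_add_distrib, Finset.sum_sub_distrib, Finset.sum_const,
      Finset.card_range, nsmul_eq_mul]
    field_simp
    ring
  rw [hsplit] at hbound
  calc _ ≤ (K : ℝ)⁻¹ * (1 / τ * Rx + 1 / σ * Ry + C * (1 + Real.log K)) := by linarith
    _ = _ := by
      rw [hC]
      ring
end

section
/- Suppose Assumption C holds, ℓ* ∈ ℝ, ε > 0, B > 0, W = [0, B] ⊂ ℝ, and define the extended Lagrangian L(x, w, y, θ; ℓ') = f(x) + g₁(x, θ) + g₂(x, y) − w·(ℓ(θ) − ℓ' − ε) − h(y). Let {(x_k, w_k, y_k, θ_k)} be generated by the four-block learning-aware iterates with positive step-sizes {τ_k, σ_k}, momentum {η_k}, positive parameters {α_k, β_k}, and an arbitrary real sequence {ℓ_k} of learning-value estimates. Suppose: (i) Ē_k(x_{k+1}, w_{k+1}, y_{k+1}, θ_{k+1}) ≤ 0 for all 0 ≤ k ≤ K−1; (ii) there are positive {t_k} with t₀ = 1, t_k/τ_k ≥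 t_{k+1}/τ_{k+1}, t_k/σ_k ≥ t_{k+1}/σ_{k+1}, t_k/t_{k+1} = η_{k+1}; and (iii) 1/σ_K ≥ η_K(α_K + β_K). For K ≥ 1 let T_K = Σ_{k=0}^{K−1} t_k and let x̄_K, w̄_K, ȳ_K, θ̄_K be the corresponding t_k-weighted averages of {x_{k+1}}, {w_{k+1}}, {y_{k+1}}, {θ_{k+1}}. Then for every x ∈ dom f, w ∈ W, y ∈ dom h, θ ∈ Θ: L(x̄_K, w̄_K, y, θ; ℓ*) − L(x, w, ȳ_K, θ̄_K; ℓ*) ≤ (1/T_K)[(1/τ₀)·D_X(x, x₀) + (1/τ₀)·D_W(w, w₀) + (1/σ₀)·D_Y(y, y₀) + (1/σ₀)·D_Θ(θ, θ₀)] + (2B/T_K)·Σ_{k=0}^{K−1} t_k |ℓ_{k+1} − ℓ*|. -/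
open RealInnerProductSpace

/-- First-order optimality of a minimizer of a convex function plus a differentiable function. -/
theorem ConvexOn.inner_gradient_nonneg_of_isMinOn {E : Type*} [NormedAddCommGroup E]
    [InnerProductSpace ℝ E] [CompleteSpace E] {S : Set E} {F φ : E → ℝ} {g z u : E}
    (hF : ConvexOn ℝ S F) (hz : z ∈ S) (hu : u ∈ S) (hφ : HasGradientAt φ g z)
    (hmin : ∀ v ∈ S, F z + φ z ≤ F v + φ v) :
    0 ≤ F u - F z + ⟪g, u - z⟫ := by
  have hline : HasDerivAt (fun r : ℝ => z + r • (u - z)) (u - z) 0 := by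
    simpa using ((hasDerivAt_id (0 : ℝ)).smul_const (u - z)).const_add z
  have hφ' : HasFDerivAt φ (InnerProductSpace.toDual ℝ E g) (z + (0 : ℝ) • (u - z)) := by
    simpa using hφ.hasFDerivAt
  have hcomp := hφ'.comp_hasDerivAt (0 : ℝ) hline
  have hslope := hcomp.tendsto_slope_zero_right
  have hlim := hslope.const_add (F u - F z)
  refine ge_of_tendsto hlim ?_
  filter_upwards [Ioo_mem_nhdsGT (zero_lt_one' ℝ)] with r hr
  have hcomb : z + r • (u - z) = (1 - r) • z + r • u := by module
  have hmem : z + r • (u - z) ∈ S := by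
    rw [hcomb]
    exact hF.1 hz hu (by linarith [hr.2]) hr.1.le (by ring)
  have hconv := hF.2 hz hu (by linarith [hr.2] : (0 : ℝ) ≤ 1 - r) hr.1.le (by ring)
  rw [← hcomb] at hconv
  have hle := hmin _ hmem
  simp only [Function.comp_apply, zero_add, zero_smul, add_zero, smul_eq_mul] at hconv ⊢
  have hscaled : 0 ≤ r * (F u - F z) + (φ (z + r • (u - z)) - φ z) := by linarith
  have heq : F u - F z + r⁻¹ * (φ (z + r • (u - z)) - φ z)
      = r⁻¹ * (r * (F u - F z) + (φ (z + r • (u - z)) - φ z)) := by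
    have := hr.1.ne'
    field_simp
  rw [heq]
  exact mul_nonneg (inv_nonneg.2 hr.1.le) hscaled

/-- A convex function lies above its linearization. -/
theorem ConvexOn.add_inner_gradient_le_s9 {E : Type*} [NormedAddCommGroup E]
    [InnerProductSpace ℝ E] [CompleteSpace E] {S : Set E} {F : E → ℝ} {g z u : E}
    (hF : ConvexOn ℝ S F) (hz : z ∈ S) (hu : u ∈ S) (hg : HasGradientAt F g z) :
    F z + ⟪g, u - z⟫ ≤ F u := by
  have hneg : HasGradientAt (-F) (-g) z := by
    rw [hasGradientAt_iff_hasFDerivAt] at hg ⊢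
    simpa using hg.neg
  have h := hF.inner_gradient_nonneg_of_isMinOn hz hu hneg (fun v _ => by simp)
  rw [inner_neg_left] at h
  linarith

/-- A concave function lies below its linearization. -/
theorem ConcaveOn.le_add_inner_gradient_s9 {E : Type*} [NormedAddCommGroup E]
    [InnerProductSpace ℝ E] [CompleteSpace E] {S : Set E} {F : E → ℝ} {g z u : E}
    (hF : ConcaveOn ℝ S F) (hz : z ∈ S) (hu : u ∈ S) (hg : HasGradientAt F g z) :
    F u ≤ F z + ⟪g, u - z⟫ := by
  have hneg : HasGradientAt (-F) (-g) z := by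
    rw [hasGradientAt_iff_hasFDerivAt] at hg ⊢
    simpa using hg.neg
  have h := hF.neg.add_inner_gradient_le_s9 hz hu hneg
  simp only [inner_neg_left, Pi.neg_apply] at h
  linarith

/-- The three-point inequality for a Bregman proximal step. -/
theorem bregman_three_point {E : Type*} [NormedAddCommGroup E]
    [InnerProductSpace ℝ E] [CompleteSpace E] {S : Set E} {F φ : E → ℝ} {gφ : E → E}
    {D : E → E → ℝ} {s z₀ z u : E} {c : ℝ}
    (hD : ∀ v v', D v v' = φ v - φ v' - ⟪gφ v', v - v'⟫)
    (hF : ConvexOn ℝ S F) (hz : z ∈ S) (hu : u ∈ S) (hφ : HasGradientAt φ (gφ z) z)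
    (hmin : ∀ v ∈ S, F z + ⟪s, z⟫ + c * D z z₀ ≤ F v + ⟪s, v⟫ + c * D v z₀) :
    F z - F u + ⟪s, z - u⟫ ≤ c * (D u z₀ - D u z - D z z₀) := by
  have hlin : ∀ a : E, HasFDerivAt (fun v : E => ⟪a, v⟫) (InnerProductSpace.toDual ℝ E a) z :=
    fun a => (InnerProductSpace.toDual ℝ E a).hasFDerivAt
  have hgrad : HasGradientAt (fun v => ⟪s, v⟫ + c * (φ v - ⟪gφ z₀, v⟫))
      (s + c • (gφ z - gφ z₀)) z := by
    rw [hasGradientAt_iff_hasFDerivAt] at hφ ⊢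
    simpa using (hlin s).fun_add ((hφ.fun_sub (hlin (gφ z₀))).const_mul c)
  have h := hF.inner_gradient_nonneg_of_isMinOn hz hu hgrad (fun v hv => by
    have := hmin v hv
    simp only [hD, inner_sub_right] at this
    linarith)
  simp only [hD, inner_add_left, inner_sub_left, inner_sub_right, real_inner_smul_left] at h ⊢
  linarith

theorem real_inner_eq_mul (a b : ℝ) : ⟪a, b⟫ = a * b := mul_comm _ _

theorem real_inner_le_young {E : Type*} [NormedAddCommGroup E] [InnerProductSpace ℝ E]
    (a d : E) {c : ℝ} (hc : 0 < c) :
    ⟪a, d⟫ ≤ 1 / (2 * c) * ‖a‖ ^ 2 + c * (1 / 2 * ‖d‖ ^ 2) := by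
  have hsq : 0 ≤ ‖a - c • d‖ ^ 2 := by positivity
  rw [norm_sub_sq_real, real_inner_smul_right, norm_smul, Real.norm_of_nonneg hc.le] at hsq
  have heq : 1 / (2 * c) * ‖a‖ ^ 2 + c * (1 / 2 * ‖d‖ ^ 2) - ⟪a, d⟫
      = 1 / (2 * c) * (‖a‖ ^ 2 - 2 * (c * ⟪a, d⟫) + (c * ‖d‖) ^ 2) := by
    field_simp
    ring
  have : 0 ≤ 1 / (2 * c) * (‖a‖ ^ 2 - 2 * (c * ⟪a, d⟫) + (c * ‖d‖) ^ 2) := by positivity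
  linarith

theorem real_inner_add_le_young {E : Type*} [NormedAddCommGroup E] [InnerProductSpace ℝ E]
    (a b d : E) {α β D : ℝ} (hα : 0 < α) (hβ : 0 < β) (hD : 1 / 2 * ‖d‖ ^ 2 ≤ D) :
    ⟪a + b, d⟫ ≤ 1 / (2 * α) * ‖a‖ ^ 2 + 1 / (2 * β) * ‖b‖ ^ 2 + (α + β) * D := by
  have ha := real_inner_le_young a d hα
  have hb := real_inner_le_young b d hβ
  have hDα := mul_le_mul_of_nonneg_left hD hα.le
  have hDβ := mul_le_mul_of_nonneg_left hD hβ.le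
  rw [inner_add_left]
  linarith

theorem one_div_two_mul_norm_add_sq_le {E : Type*} [NormedAddCommGroup E]
    [InnerProductSpace ℝ E] (a b : E) {c : ℝ} (hc : 0 < c) :
    1 / (2 * c) * ‖a + b‖ ^ 2 ≤ 1 / c * ‖a‖ ^ 2 + 1 / c * ‖b‖ ^ 2 := by
  have hpar := parallelogram_law_with_norm ℝ a b
  have hsq : ‖a + b‖ ^ 2 ≤ 2 * (‖a‖ ^ 2 + ‖b‖ ^ 2) := by nlinarith [sq_nonneg ‖a - b‖]
  calc 1 / (2 * c) * ‖a + b‖ ^ 2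
      ≤ 1 / (2 * c) * (2 * (‖a‖ ^ 2 + ‖b‖ ^ 2)) := by gcongr
    _ = 1 / c * ‖a‖ ^ 2 + 1 / c * ‖b‖ ^ 2 := by field_simp

/-- Weighted summation of a one-step inequality whose extrapolation terms telescope. -/
theorem sum_mul_le_of_extrapolated_step {t τ σ η U V P R G e : ℕ → ℝ} {b c : ℝ} {K : ℕ}
    (ht : ∀ k, 0 < t k) (ht₀ : t 0 = 1) (hη : ∀ k, t k = t (k + 1) * η (k + 1))
    (hτ : ∀ k, t (k + 1) / τ (k + 1) ≤ t k / τ k)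
    (hσ : ∀ k, t (k + 1) / σ (k + 1) ≤ t k / σ k) (hτ_pos : 0 < τ K) (hη_nonneg : 0 ≤ η K)
    (hU : ∀ k, 0 ≤ U k) (hV : ∀ k, 0 ≤ V k) (hP₀ : P 0 = 0) (hR₀ : R 0 = 0)
    (hstep : ∀ k < K, G k ≤ 1 / τ k * (U k - U (k + 1)) + 1 / σ k * (V k - V (k + 1))
      + (P (k + 1) - η k * P k) + (η k * R k - R (k + 1)) + b * e k)
    (hPK : P K ≤ R K + c * V K) (hc : η K * c ≤ 1 / σ K) :
    ∑ k ∈ Finset.range K, t k * G k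
      ≤ 1 / τ 0 * U 0 + 1 / σ 0 * V 0 + b * ∑ k ∈ Finset.range K, t k * e k := by
  have hpartial : ∀ n ≤ K, ∑ k ∈ Finset.range n, t k * G k
      ≤ 1 / τ 0 * U 0 + 1 / σ 0 * V 0 - t n / τ n * U n - t n / σ n * V n
        + t n * η n * (P n - R n) + b * ∑ k ∈ Finset.range n, t k * e k := by
    intro n
    induction n with
    | zero => intro _; simp [ht₀, hP₀, hR₀]
    | succ n ih =>
      intro hn
      have hprev := ih (by omega)
      have hs := mul_le_mul_of_nonneg_left (hstep n hn) (ht n).le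
      have hUn := mul_le_mul_of_nonneg_right (hτ n) (hU (n + 1))
      have hVn := mul_le_mul_of_nonneg_right (hσ n) (hV (n + 1))
      rw [Finset.sum_range_succ, Finset.sum_range_succ, ← hη n]
      have hexpand : t n * (1 / τ n * (U n - U (n + 1)) + 1 / σ n * (V n - V (n + 1))
          + (P (n + 1) - η n * P n) + (η n * R n - R (n + 1)) + b * e n)
          = t n / τ n * U n - t n / τ n * U (n + 1) + t n / σ n * V n - t n / σ n * V (n + 1)
            + t n * (P (n + 1) - R (n + 1)) - t n * η n * (P n - R n) + b * (t n * e n) := by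
        ring
      rw [hexpand] at hs
      linarith
  have hK := hpartial K le_rfl
  have hUK : 0 ≤ t K / τ K * U K := mul_nonneg (div_nonneg (ht K).le hτ_pos.le) (hU K)
  have hPR : t K * η K * (P K - R K) ≤ t K * η K * (c * V K) :=
    mul_le_mul_of_nonneg_left (by linarith) (mul_nonneg (ht K).le hη_nonneg)
  have hcV : t K * V K * (η K * c) ≤ t K * V K * (1 / σ K) :=
    mul_le_mul_of_nonneg_left hc (mul_nonneg (ht K).le (hV K))
  have h₁ : t K * η K * (c * V K) = t K * V K * (η K * c) := by ring
  have h₂ : t K / σ K * V K = t K * V K * (1 / σ K) := by ring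
  linarith

/-- Jensen's inequality for a normalized weighted average of a finite sequence. -/
theorem ConvexOn.mul_map_average_le {E : Type*} [AddCommGroup E] [Module ℝ E] {S : Set E}
    {F : E → ℝ} (hF : ConvexOn ℝ S F) {t : ℕ → ℝ} {p : ℕ → E} {K : ℕ} (ht : ∀ k, 0 ≤ t k)
    (hsum : 0 < ∑ k ∈ Finset.range K, t k) (hp : ∀ k, p k ∈ S) :
    (∑ k ∈ Finset.range K, t k)
        * F ((∑ k ∈ Finset.range K, t k)⁻¹ • ∑ k ∈ Finset.range K, t k • p k)
      ≤ ∑ k ∈ Finset.range K, t k * F (p k) := by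
  have h := hF.map_centerMass_le (t := Finset.range K) (w := t) (p := p)
    (fun k _ => ht k) hsum (fun k _ => hp k)
  simp only [Finset.centerMass, smul_eq_mul, Function.comp_apply] at h
  calc _ ≤ (∑ k ∈ Finset.range K, t k)
        * ((∑ k ∈ Finset.range K, t k)⁻¹ * ∑ k ∈ Finset.range K, t k * F (p k)) :=
        mul_le_mul_of_nonneg_left h hsum.le
    _ = _ := mul_inv_cancel_left₀ hsum.ne' _

theorem stmt_9
    {X : Type*} [NormedAddCommGroup X] [InnerProductSpace ℝ X] [FiniteDimensional ℝ X]
    {Y : Type*} [NormedAddCommGroup Y] [InnerProductSpace ℝ Y] [FiniteDimensional ℝ Y]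
    {T : Type*} [NormedAddCommGroup T] [InnerProductSpace ℝ T] [FiniteDimensional ℝ T]
    (domf : Set X) (domh : Set Y) (Θset : Set T)
    (hdomf_ne : domf.Nonempty) (hdomh_ne : domh.Nonempty)
    (hdomf_conv : Convex ℝ domf) (hdomh_conv : Convex ℝ domh)
    (hΘ_conv : Convex ℝ Θset) (hΘ_ne : Θset.Nonempty)
    (B : ℝ) (hB : 0 < B) (ε : ℝ) (hε : 0 < ε) (ℓstar : ℝ)
    (f : X → ℝ) (h : Y → ℝ)
    (hfconv : ConvexOn ℝ domf f) (hhconv : ConvexOn ℝ domh h)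
    (hflsc : LowerSemicontinuousOn f domf) (hhlsc : LowerSemicontinuousOn h domh)
    (g1 : X → T → ℝ) (g2 : X → Y → ℝ) (ℓf : T → ℝ)
    (g1x : X → T → X) (g1θ : X → T → T)
    (g2x : X → Y → X) (g2y : X → Y → Y) (gℓ : T → T)
    (L1xx L1xθ L2xx L2xy L2yx L2yy L1θx L1θθ Lℓθ Lℓw : ℝ)
    (hL1xx : 0 ≤ L1xx) (hL1xθ : 0 ≤ L1xθ) (hL2xx : 0 ≤ L2xx) (hL2xy : 0 ≤ L2xy)
    (hL2yx : 0 ≤ L2yx) (hL2yy : 0 ≤ L2yy) (hL1θx : 0 ≤ L1θx) (hL1θθ : 0 ≤ L1θθ)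
    (hLℓθ : 0 ≤ Lℓθ) (hLℓw : 0 ≤ Lℓw)
    (hg1convx : ∀ θ ∈ Θset, ConvexOn ℝ domf (fun x => g1 x θ))
    (hg2convx : ∀ y ∈ domh, ConvexOn ℝ domf (fun x => g2 x y))
    (hg1x : ∀ x ∈ domf, ∀ θ ∈ Θset, HasGradientAt (fun x' => g1 x' θ) (g1x x θ) x)
    (hg1θ : ∀ x ∈ domf, ∀ θ ∈ Θset, HasGradientAt (fun θ' => g1 x θ') (g1θ x θ) θ)
    (hg2x : ∀ x ∈ domf, ∀ y ∈ domh, HasGradientAt (fun x' => g2 x' y) (g2x x y) x)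
    (hg2y : ∀ x ∈ domf, ∀ y ∈ domh, HasGradientAt (fun y' => g2 x y') (g2y x y) y)
    (hgℓ : ∀ θ ∈ Θset, HasGradientAt ℓf (gℓ θ) θ)
    (hLip1x : ∀ x ∈ domf, ∀ x' ∈ domf, ∀ θ ∈ Θset, ∀ θ' ∈ Θset,
      ‖g1x x θ - g1x x' θ'‖ ≤ L1xx * ‖x - x'‖ + L1xθ * ‖θ - θ'‖)
    (hLip2x : ∀ x ∈ domf, ∀ x' ∈ domf, ∀ y ∈ domh, ∀ y' ∈ domh,
      ‖g2x x y - g2x x' y'‖ ≤ L2xx * ‖x - x'‖ + L2xy * ‖y - y'‖)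
    (hLip2y : ∀ x ∈ domf, ∀ x' ∈ domf, ∀ y ∈ domh, ∀ y' ∈ domh,
      ‖g2y x y - g2y x' y'‖ ≤ L2yx * ‖x - x'‖ + L2yy * ‖y - y'‖)
    (hLip1θ : ∀ x ∈ domf, ∀ x' ∈ domf, ∀ θ ∈ Θset, ∀ θ' ∈ Θset,
      ‖g1θ x θ - g1θ x' θ'‖ ≤ L1θx * ‖x - x'‖ + L1θθ * ‖θ - θ'‖)
    (hLipℓ : ∀ θ ∈ Θset, ∀ θ' ∈ Θset, ∀ w ∈ Set.Icc (0 : ℝ) B, ∀ w' ∈ Set.Icc (0 : ℝ) B,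
      ‖w' • gℓ θ' - w • gℓ θ‖ ≤ Lℓθ * ‖θ - θ'‖ + Lℓw * |w - w'|)
    (hg1conc : ∀ x ∈ domf, ConcaveOn ℝ Θset (fun θ => g1 x θ))
    (hg2conc : ∀ x ∈ domf, ConcaveOn ℝ domh (fun y => g2 x y))
    (hℓconv : ConvexOn ℝ Θset ℓf)
    (φX : X → ℝ) (gφX : X → X) (UX : Set X) (hUXopen : IsOpen UX) (hUXf : domf ⊆ UX)
    (hφX : ∀ x ∈ UX, HasGradientAt φX (gφX x) x)
    (DX : X → X → ℝ)
    (hDXdef : ∀ x x', DX x x' = φX x - φX x' - ⟪gφX x', x - x'⟫)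
    (hDXlb : ∀ x, ∀ x' ∈ domf, 1 / 2 * ‖x - x'‖ ^ 2 ≤ DX x x')
    (φY : Y → ℝ) (gφY : Y → Y) (UY : Set Y) (hUYopen : IsOpen UY) (hUYh : domh ⊆ UY)
    (hφY : ∀ y ∈ UY, HasGradientAt φY (gφY y) y)
    (DY : Y → Y → ℝ)
    (hDYdef : ∀ y y', DY y y' = φY y - φY y' - ⟪gφY y', y - y'⟫)
    (hDYlb : ∀ y, ∀ y' ∈ domh, 1 / 2 * ‖y - y'‖ ^ 2 ≤ DY y y')
    (φT : T → ℝ) (gφT : T → T) (UT : Set T) (hUTopen : IsOpen UT) (hUTθ : Θset ⊆ UT)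
    (hφT : ∀ θ ∈ UT, HasGradientAt φT (gφT θ) θ)
    (DΘ : T → T → ℝ)
    (hDΘdef : ∀ θ θ', DΘ θ θ' = φT θ - φT θ' - ⟪gφT θ', θ - θ'⟫)
    (hDΘlb : ∀ θ, ∀ θ' ∈ Θset, 1 / 2 * ‖θ - θ'‖ ^ 2 ≤ DΘ θ θ')
    (φW : ℝ → ℝ) (dφW : ℝ → ℝ) (UW : Set ℝ) (hUWopen : IsOpen UW) (hUWw : Set.Icc (0 : ℝ) B ⊆ UW)
    (hφW : ∀ w ∈ UW, HasDerivAt φW (dφW w) w)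
    (DW : ℝ → ℝ → ℝ)
    (hDWdef : ∀ w w', DW w w' = φW w - φW w' - dφW w' * (w - w'))
    (hDWlb : ∀ w : ℝ, ∀ w' ∈ Set.Icc (0 : ℝ) B, 1 / 2 * |w - w'| ^ 2 ≤ DW w w')
    (τs σs ηs αs βs : ℕ → ℝ)
    (hτs : ∀ k, 0 < τs k) (hσs : ∀ k, 0 < σs k) (hηs : ∀ k, 0 ≤ ηs k)
    (hαs : ∀ k, 0 < αs k) (hβs : ∀ k, 0 < βs k)
    (xx : ℕ → X) (ww : ℕ → ℝ) (yy : ℕ → Y) (θθ : ℕ → T) (ℓk : ℕ → ℝ)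
    (hxx : ∀ k, xx k ∈ domf) (hww : ∀ k, ww k ∈ Set.Icc (0 : ℝ) B)
    (hyy : ∀ k, yy k ∈ domh) (hθθ : ∀ k, θθ k ∈ Θset)
    (hyupd : ∀ k : ℕ, ∀ y' ∈ domh,
      h (yy (k + 1))
        - ⟪(1 + ηs k) • g2y (xx k) (yy k) - ηs k • g2y (xx (k - 1)) (yy (k - 1)), yy (k + 1)⟫
        + 1 / σs k * DY (yy (k + 1)) (yy k)
      ≤ h y'
        - ⟪(1 + ηs k) • g2y (xx k) (yy k) - ηs k • g2y (xx (k - 1)) (yy (k - 1)), y'⟫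
        + 1 / σs k * DY y' (yy k))
    (hθupd : ∀ k : ℕ, ∀ θ' ∈ Θset,
      -⟪(1 + ηs k) • (g1θ (xx k) (θθ k) - ww k • gℓ (θθ k))
          - ηs k • (g1θ (xx (k - 1)) (θθ (k - 1)) - ww (k - 1) • gℓ (θθ (k - 1))), θθ (k + 1)⟫
        + 1 / σs k * DΘ (θθ (k + 1)) (θθ k)
      ≤ -⟪(1 + ηs k) • (g1θ (xx k) (θθ k) - ww k • gℓ (θθ k))
          - ηs k • (g1θ (xx (k - 1)) (θθ (k - 1)) - ww (k - 1) • gℓ (θθ (k - 1))), θ'⟫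
        + 1 / σs k * DΘ θ' (θθ k))
    (hxupd : ∀ k : ℕ, ∀ x' ∈ domf,
      f (xx (k + 1)) + ⟪g1x (xx k) (θθ (k + 1)) + g2x (xx k) (yy (k + 1)), xx (k + 1)⟫
        + 1 / τs k * DX (xx (k + 1)) (xx k)
      ≤ f x' + ⟪g1x (xx k) (θθ (k + 1)) + g2x (xx k) (yy (k + 1)), x'⟫
        + 1 / τs k * DX x' (xx k))
    (hwupd : ∀ k : ℕ, ∀ w' ∈ Set.Icc (0 : ℝ) B,
      -((ℓf (θθ (k + 1)) - ℓk (k + 1) - ε) * ww (k + 1)) + 1 / τs k * DW (ww (k + 1)) (ww k)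
      ≤ -((ℓf (θθ (k + 1)) - ℓk (k + 1) - ε) * w') + 1 / τs k * DW w' (ww k))
    (ts : ℕ → ℝ) (htpos : ∀ k, 0 < ts k) (ht0 : ts 0 = 1)
    (htτ : ∀ k : ℕ, ts (k + 1) / τs (k + 1) ≤ ts k / τs k)
    (htσ : ∀ k : ℕ, ts (k + 1) / σs (k + 1) ≤ ts k / σs k)
    (htη : ∀ k : ℕ, ts k / ts (k + 1) = ηs (k + 1))
    :
    ∀ K : ℕ, 1 ≤ K →
    (∀ k < K,
      (g1 (xx (k + 1)) (θθ (k + 1)) - g1 (xx k) (θθ (k + 1))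
          - ⟪g1x (xx k) (θθ (k + 1)), xx (k + 1) - xx k⟫)
        + (g2 (xx (k + 1)) (yy (k + 1)) - g2 (xx k) (yy (k + 1))
            - ⟪g2x (xx k) (yy (k + 1)), xx (k + 1) - xx k⟫)
        + 1 / (2 * αs (k + 1)) * ‖g2y (xx (k + 1)) (yy (k + 1)) - g2y (xx k) (yy (k + 1))‖ ^ 2
        + 1 / βs (k + 1) * ‖g2y (xx k) (yy (k + 1)) - g2y (xx k) (yy k)‖ ^ 2
        + 1 / αs (k + 1) * ‖g1θ (xx (k + 1)) (θθ (k + 1)) - g1θ (xx k) (θθ (k + 1))‖ ^ 2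
        + 1 / αs (k + 1) * ‖g1θ (xx k) (θθ (k + 1)) - g1θ (xx k) (θθ k)‖ ^ 2
        + 1 / βs (k + 1) * ‖(ww k - ww (k + 1)) • gℓ (θθ (k + 1))‖ ^ 2
        + 1 / βs (k + 1) * ‖ww k • (gℓ (θθ k) - gℓ (θθ (k + 1)))‖ ^ 2
        - (1 / σs k - ηs k * (αs k + βs k)) * (DY (yy (k + 1)) (yy k) + DΘ (θθ (k + 1)) (θθ k))
        - 1 / τs k * (DX (xx (k + 1)) (xx k) + DW (ww (k + 1)) (ww k)) ≤ 0) →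
    1 / σs K ≥ ηs K * (αs K + βs K) →
    ∀ TK : ℝ, TK = ∑ k ∈ Finset.range K, ts k →
    ∀ xb : X, xb = TK⁻¹ • ∑ k ∈ Finset.range K, ts k • xx (k + 1) →
    ∀ wb : ℝ, wb = TK⁻¹ * ∑ k ∈ Finset.range K, ts k * ww (k + 1) →
    ∀ yb : Y, yb = TK⁻¹ • ∑ k ∈ Finset.range K, ts k • yy (k + 1) →
    ∀ θb : T, θb = TK⁻¹ • ∑ k ∈ Finset.range K, ts k • θθ (k + 1) →
    ∀ x ∈ domf, ∀ w ∈ Set.Icc (0 : ℝ) B, ∀ y ∈ domh, ∀ θ ∈ Θset,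
      (f xb + g1 xb θ + g2 xb y - wb * (ℓf θ - ℓstar - ε) - h y)
        - (f x + g1 x θb + g2 x yb - w * (ℓf θb - ℓstar - ε) - h yb)
      ≤ 1 / TK * (1 / τs 0 * DX x (xx 0) + 1 / τs 0 * DW w (ww 0)
          + 1 / σs 0 * DY y (yy 0) + 1 / σs 0 * DΘ θ (θθ 0))
        + 2 * B / TK * ∑ k ∈ Finset.range K, ts k * |ℓk (k + 1) - ℓstar| := by
  intro K hK hE hK_σ TK hTK xb hxb wb hwb yb hyb θb hθb x hx w hw y hy θ hθ
  have hTK_pos : 0 < TK := by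
    rw [hTK]
    exact Finset.sum_pos (fun k _ => htpos k) (Finset.nonempty_range_iff.2 (by omega))
  have hDX : ∀ u, ∀ v ∈ domf, 0 ≤ DX u v := fun u v hv =>
    le_trans (by positivity) (hDXlb u v hv)
  have hDY : ∀ u, ∀ v ∈ domh, 0 ≤ DY u v := fun u v hv =>
    le_trans (by positivity) (hDYlb u v hv)
  have hDΘ : ∀ u, ∀ v ∈ Θset, 0 ≤ DΘ u v := fun u v hv =>
    le_trans (by positivity) (hDΘlb u v hv)
  have hDW : ∀ u, ∀ v ∈ Set.Icc (0 : ℝ) B, 0 ≤ DW u v := fun u v hv =>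
    le_trans (by positivity) (hDWlb u v hv)
  let qy : ℕ → Y := fun k => g2y (xx k) (yy k)
  let qθ : ℕ → T := fun k => g1θ (xx k) (θθ k) - ww k • gℓ (θθ k)
  let Ry : ℕ → ℝ := fun k =>
    1 / (2 * αs k) * ‖g2y (xx k) (yy k) - g2y (xx (k - 1)) (yy k)‖ ^ 2
      + 1 / βs k * ‖g2y (xx (k - 1)) (yy k) - g2y (xx (k - 1)) (yy (k - 1))‖ ^ 2
  let Rθ : ℕ → ℝ := fun k =>
    1 / αs k * ‖g1θ (xx k) (θθ k) - g1θ (xx (k - 1)) (θθ k)‖ ^ 2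
      + 1 / αs k * ‖g1θ (xx (k - 1)) (θθ k) - g1θ (xx (k - 1)) (θθ (k - 1))‖ ^ 2
      + 1 / βs k * ‖(ww (k - 1) - ww k) • gℓ (θθ k)‖ ^ 2
      + 1 / βs k * ‖ww (k - 1) • (gℓ (θθ (k - 1)) - gℓ (θθ k))‖ ^ 2
  have hcross_y : ∀ k (d : Y) (D : ℝ), 1 / 2 * ‖d‖ ^ 2 ≤ D →
      ⟪qy k - qy (k - 1), d⟫ ≤ Ry k + (αs k + βs k) * D := by
    intro k d D hd
    have h₁ := real_inner_add_le_young (g2y (xx k) (yy k) - g2y (xx (k - 1)) (yy k))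
      (g2y (xx (k - 1)) (yy k) - g2y (xx (k - 1)) (yy (k - 1))) d (hαs k) (hβs k) hd
    have h₂ : 1 / (2 * βs k) * ‖g2y (xx (k - 1)) (yy k) - g2y (xx (k - 1)) (yy (k - 1))‖ ^ 2
        ≤ 1 / βs k * ‖g2y (xx (k - 1)) (yy k) - g2y (xx (k - 1)) (yy (k - 1))‖ ^ 2 := by
      have := hβs k
      gcongr
      linarith
    rw [sub_add_sub_cancel] at h₁
    simp only [qy, Ry]
    linarith
  have hcross_θ : ∀ k (d : T) (D : ℝ), 1 / 2 * ‖d‖ ^ 2 ≤ D →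
      ⟪qθ k - qθ (k - 1), d⟫ ≤ Rθ k + (αs k + βs k) * D := by
    intro k d D hd
    have h₁ := real_inner_add_le_young
      ((g1θ (xx k) (θθ k) - g1θ (xx (k - 1)) (θθ k))
        + (g1θ (xx (k - 1)) (θθ k) - g1θ (xx (k - 1)) (θθ (k - 1))))
      ((ww (k - 1) - ww k) • gℓ (θθ k) + ww (k - 1) • (gℓ (θθ (k - 1)) - gℓ (θθ k)))
      d (hαs k) (hβs k) hd
    have h₂ := one_div_two_mul_norm_add_sq_le (g1θ (xx k) (θθ k) - g1θ (xx (k - 1)) (θθ k))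
      (g1θ (xx (k - 1)) (θθ k) - g1θ (xx (k - 1)) (θθ (k - 1))) (hαs k)
    have h₃ := one_div_two_mul_norm_add_sq_le ((ww (k - 1) - ww k) • gℓ (θθ k))
      (ww (k - 1) • (gℓ (θθ (k - 1)) - gℓ (θθ k))) (hβs k)
    have hsplit : qθ k - qθ (k - 1) =
        ((g1θ (xx k) (θθ k) - g1θ (xx (k - 1)) (θθ k))
          + (g1θ (xx (k - 1)) (θθ k) - g1θ (xx (k - 1)) (θθ (k - 1))))
        + ((ww (k - 1) - ww k) • gℓ (θθ k) + ww (k - 1) • (gℓ (θθ (k - 1)) - gℓ (θθ k))) := by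
      simp only [qθ]
      module
    rw [hsplit]
    simp only [Rθ]
    linarith
  let P : ℕ → ℝ := fun k => ⟪qy k - qy (k - 1), y - yy k⟫ + ⟪qθ k - qθ (k - 1), θ - θθ k⟫
  let gap : ℕ → ℝ := fun k =>
    (f (xx (k + 1)) + g1 (xx (k + 1)) θ + g2 (xx (k + 1)) y
        - ww (k + 1) * (ℓf θ - ℓstar - ε) - h y)
      - (f x + g1 x (θθ (k + 1)) + g2 x (yy (k + 1))
        - w * (ℓf (θθ (k + 1)) - ℓstar - ε) - h (yy (k + 1)))
  have hstep : ∀ k < K, gap k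
      ≤ 1 / τs k * ((DX x (xx k) + DW w (ww k)) - (DX x (xx (k + 1)) + DW w (ww (k + 1))))
        + 1 / σs k * ((DY y (yy k) + DΘ θ (θθ k)) - (DY y (yy (k + 1)) + DΘ θ (θθ (k + 1))))
        + (P (k + 1) - ηs k * P k) + (ηs k * (Ry k + Rθ k) - (Ry (k + 1) + Rθ (k + 1)))
        + B * |ℓk (k + 1) - ℓstar| := by
    intro k hk
    have hx₁ := hxx (k + 1)
    have hy₁ := hyy (k + 1)
    have hθ₁ := hθθ (k + 1)
    have hw₁ := hww (k + 1)
    have prox_x := bregman_three_point (c := 1 / τs k) hDXdef hfconv hx₁ hx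
      (hφX _ (hUXf hx₁)) (hxupd k)
    have prox_y := bregman_three_point (c := 1 / σs k)
      (s := -((1 + ηs k) • g2y (xx k) (yy k) - ηs k • g2y (xx (k - 1)) (yy (k - 1))))
      hDYdef hhconv hy₁ hy (hφY _ (hUYh hy₁)) (fun v hv => by
        simpa only [inner_neg_left, ← sub_eq_add_neg] using hyupd k v hv)
    have prox_θ := bregman_three_point (c := 1 / σs k) (F := fun _ => (0 : ℝ))
      (s := -((1 + ηs k) • (g1θ (xx k) (θθ k) - ww k • gℓ (θθ k))
          - ηs k • (g1θ (xx (k - 1)) (θθ (k - 1)) - ww (k - 1) • gℓ (θθ (k - 1)))))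
      hDΘdef (convexOn_const 0 hΘ_conv) hθ₁ hθ (hφT _ (hUTθ hθ₁)) (fun v hv => by
        simpa only [inner_neg_left, zero_add] using hθupd k v hv)
    have prox_w := bregman_three_point (c := 1 / τs k) (F := fun _ => (0 : ℝ)) (gφ := dφW)
      (s := -(ℓf (θθ (k + 1)) - ℓk (k + 1) - ε)) (z₀ := ww k) (D := DW) (φ := φW)
      (fun v v' => by rw [hDWdef, real_inner_eq_mul])
      (convexOn_const 0 (convex_Icc 0 B)) hw₁ hw
      (hφW _ (hUWw hw₁)).hasGradientAt (fun v hv => by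
        simpa only [inner_neg_left, real_inner_eq_mul, zero_add] using hwupd k v hv)
    have conc_θ := (hg1conc _ hx₁).le_add_inner_gradient_s9 hθ₁ hθ (hg1θ _ hx₁ _ hθ₁)
    have conc_y := (hg2conc _ hx₁).le_add_inner_gradient_s9 hy₁ hy (hg2y _ hx₁ _ hy₁)
    have conv_ℓ := mul_le_mul_of_nonneg_left
      (hℓconv.add_inner_gradient_le_s9 hθ₁ hθ (hgℓ _ hθ₁)) hw₁.1
    have conv_x₁ := (hg1convx _ hθ₁).add_inner_gradient_le_s9 (hxx k) hx (hg1x _ (hxx k) _ hθ₁)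
    have conv_x₂ := (hg2convx _ hy₁).add_inner_gradient_le_s9 (hxx k) hx (hg2x _ (hxx k) _ hy₁)
    have cross_y := mul_le_mul_of_nonneg_left
      (hcross_y k (yy (k + 1) - yy k) _ (hDYlb _ _ (hyy k))) (hηs k)
    have cross_θ := mul_le_mul_of_nonneg_left
      (hcross_θ k (θθ (k + 1) - θθ k) _ (hDΘlb _ _ (hθθ k))) (hηs k)
    have hlearn : -((ww (k + 1) - w) * (ℓk (k + 1) - ℓstar)) ≤ B * |ℓk (k + 1) - ℓstar| := by
      have hdist : |ww (k + 1) - w| ≤ B :=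
        abs_le.2 ⟨by linarith [hw₁.1, hw.2], by linarith [hw₁.2, hw.1]⟩
      calc _ ≤ |(ww (k + 1) - w) * (ℓk (k + 1) - ℓstar)| := neg_le_abs _
        _ = |ww (k + 1) - w| * |ℓk (k + 1) - ℓstar| := abs_mul _ _
        _ ≤ _ := by gcongr
    have hEk := hE k hk
    simp only [gap, P, qy, qθ, Ry, Rθ, Nat.add_sub_cancel] at cross_y cross_θ ⊢
    simp only [inner_add_left, inner_sub_left, inner_sub_right, inner_neg_left,
      real_inner_smul_left, real_inner_eq_mul]
      at prox_x prox_y prox_θ prox_w conc_θ conc_y conv_ℓ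
        conv_x₁ conv_x₂ cross_y cross_θ hEk ⊢
    linarith
  have htele := sum_mul_le_of_extrapolated_step (t := ts) (τ := τs) (σ := σs) (η := ηs)
    (U := fun k => DX x (xx k) + DW w (ww k)) (V := fun k => DY y (yy k) + DΘ θ (θθ k))
    (P := P) (R := fun k => Ry k + Rθ k) (G := gap) (e := fun k => |ℓk (k + 1) - ℓstar|)
    (b := B) (c := αs K + βs K) (K := K) htpos ht0
    (fun k => by rw [← htη, mul_div_cancel₀ _ (htpos (k + 1)).ne'])
    htτ htσ (hτs K) (hηs K)
    (fun k => add_nonneg (hDX _ _ (hxx k)) (hDW _ _ (hww k)))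
    (fun k => add_nonneg (hDY _ _ (hyy k)) (hDΘ _ _ (hθθ k)))
    (by simp [P]) (by simp [Ry, Rθ]) hstep
    (by
      have h₁ := hcross_y K (y - yy K) _ (hDYlb _ _ (hyy K))
      have h₂ := hcross_θ K (θ - θθ K) _ (hDΘlb _ _ (hθθ K))
      simp only [P]
      linarith)
    hK_σ
  have ht_nonneg : ∀ k, 0 ≤ ts k := fun k => (htpos k).le
  have jensen_x := ((hfconv.add (hg1convx θ hθ)).add (hg2convx y hy)).mul_map_average_le
    ht_nonneg (hTK ▸ hTK_pos) (fun k => hxx (k + 1))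
  have jensen_y := (hhconv.sub (hg2conc x hx)).mul_map_average_le
    ht_nonneg (hTK ▸ hTK_pos) (fun k => hyy (k + 1))
  have jensen_θ := ((hℓconv.smul hw.1).sub (hg1conc x hx)).mul_map_average_le
    ht_nonneg (hTK ▸ hTK_pos) (fun k => hθθ (k + 1))
  simp only [← hTK, ← hxb, ← hyb, ← hθb, Pi.add_apply, Pi.sub_apply, smul_eq_mul]
    at jensen_x jensen_y jensen_θ
  have hwb_mul : TK * wb = ∑ k ∈ Finset.range K, ts k * ww (k + 1) := by
    rw [hwb, mul_inv_cancel_left₀ hTK_pos.ne']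
  have hgap_sum : ∑ k ∈ Finset.range K, ts k * gap k
      = ∑ k ∈ Finset.range K, ts k * (f (xx (k + 1)) + g1 (xx (k + 1)) θ + g2 (xx (k + 1)) y)
        + ∑ k ∈ Finset.range K, ts k * (h (yy (k + 1)) - g2 x (yy (k + 1)))
        + ∑ k ∈ Finset.range K, ts k * (w * ℓf (θθ (k + 1)) - g1 x (θθ (k + 1)))
        - (∑ k ∈ Finset.range K, ts k * ww (k + 1)) * (ℓf θ - ℓstar - ε)
        - (∑ k ∈ Finset.range K, ts k) * (h y + f x + w * (ℓstar + ε)) := by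
    simp only [Finset.sum_mul, ← Finset.sum_add_distrib, ← Finset.sum_sub_distrib]
    refine Finset.sum_congr rfl fun k _ => ?_
    simp only [gap]
    ring
  rw [← hwb_mul, ← hTK] at hgap_sum
  have herr : 0 ≤ B * ∑ k ∈ Finset.range K, ts k * |ℓk (k + 1) - ℓstar| :=
    mul_nonneg hB.le (Finset.sum_nonneg fun k _ => mul_nonneg (ht_nonneg k) (abs_nonneg _))
  rw [← mul_le_mul_iff_right₀ hTK_pos]
  have hrhs : TK * (1 / TK * (1 / τs 0 * DX x (xx 0) + 1 / τs 0 * DW w (ww 0)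
        + 1 / σs 0 * DY y (yy 0) + 1 / σs 0 * DΘ θ (θθ 0))
      + 2 * B / TK * ∑ k ∈ Finset.range K, ts k * |ℓk (k + 1) - ℓstar|)
      = 1 / τs 0 * (DX x (xx 0) + DW w (ww 0)) + 1 / σs 0 * (DY y (yy 0) + DΘ θ (θθ 0))
        + 2 * (B * ∑ k ∈ Finset.range K, ts k * |ℓk (k + 1) - ℓstar|) := by
    field_simp
    ring
  rw [hrhs]
  linarith
end
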